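/- Let α and β be finite index types and let M be an invertible real square matrix indexed by α ⊕ β, written in block form M = fromBlocks A B C D, and assume that the block D is invertible. Write the inverse in block form M⁻¹ = fromBlocks A' B' C' D'. Then the block A' is invertible and D⁻¹ = D' − C' (A')⁻¹ B'; that is, the inverse of the lower-right block of M equals the Schur complement of M⁻¹ with respect to the α-block. -/

import Mathlib

open Matrix

theorem inv_block_eq_schur_complement_of_inverse
    {α β : Type*} [Fintype α] [Fintype β] [DecidableEq α] [DecidableEq β]
    (A : Matrix α α ℝ) (B : Matrix α β ℝ) (C : Matrix β α ℝ) (D : Matrix β β ℝ)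
    (A' : Matrix α α ℝ) (B' : Matrix α β ℝ) (C' : Matrix β α ℝ) (D' : Matrix β β ℝ)
    (M : Matrix (α ⊕ β) (α ⊕ β) ℝ)
    (hM : IsUnit M)
    (hblock : M = Matrix.fromBlocks A B C D)
    (hD : IsUnit D)
    (hinv : M⁻¹ = Matrix.fromBlocks A' B' C' D') :
    IsUnit A' ∧ D⁻¹ = D' - C' * A'⁻¹ * B' := by
  have hMM : M * M⁻¹ = 1 := Matrix.mul_nonsing_inv M ((Matrix.isUnit_iff_isUnit_det M).1 hM)
  rw [hinv, hblock, Matrix.fromBlocks_multiply, ← Matrix.fromBlocks_one,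
    Matrix.fromBlocks_inj] at hMM
  obtain ⟨h11, -, h21, h22⟩ := hMM
  have hDD : D⁻¹ * D = 1 := Matrix.nonsing_inv_mul D ((Matrix.isUnit_iff_isUnit_det D).1 hD)
  have hDC : D * C' = -(C * A') := eq_neg_of_add_eq_zero_right h21
  have hC : C' = -(D⁻¹ * (C * A')) := by
    rw [← Matrix.mul_neg, ← hDC, ← Matrix.mul_assoc, hDD, Matrix.one_mul]
  have hA1 : (A - B * D⁻¹ * C) * A' = 1 := by
    rw [← h11, Matrix.sub_mul, hC, Matrix.mul_neg, sub_eq_add_neg]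
    simp only [Matrix.mul_assoc]
  have hA : IsUnit A' :=
    (Matrix.isUnit_iff_isUnit_det A').2 (Matrix.isUnit_det_of_left_inverse hA1)
  have hAA : A' * A'⁻¹ = 1 := Matrix.mul_nonsing_inv A' ((Matrix.isUnit_iff_isUnit_det A').1 hA)
  refine ⟨hA, Matrix.inv_eq_right_inv ?_⟩
  rw [Matrix.mul_sub, ← Matrix.mul_assoc, ← Matrix.mul_assoc, hDC, Matrix.neg_mul,
    Matrix.mul_assoc C, hAA, Matrix.mul_one, Matrix.neg_mul, sub_neg_eq_add, add_comm, h22]
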